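/- Let S > 0, 0 < γ ≤ 1, and let d, k be real numbers with d > k ≥ 1. Then there exists N₀ > 0 such that for every real N ≥ N₀, p̂(S, N, γ, k) < p̂(S, N, γ, d). -/

import Mathlib

open MeasureTheory

/-- The Gaussian tail function `Q(x) = (1/√(2π)) · ∫_x^∞ exp(−t²/2) dt`. -/
noncomputable def gaussQ (x : ℝ) : ℝ :=
  (Real.sqrt (2 * Real.pi))⁻¹ * ∫ t in Set.Ioi x, Real.exp (-t ^ 2 / 2)

/-- The approximate probability of error `p̂(S, N, γ, q)` from the paper. -/
noncomputable def phat (S N γ q : ℝ) : ℝ :=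
  (1 / 2) * gaussQ ((Real.sqrt S + (1 / (4 * N)) * ((1 - γ) / γ) * (q / Real.sqrt S)) /
      Real.sqrt ((1 / (4 * N)) * ((1 + γ) / γ) * (q / S)
        + (1 / (8 * N ^ 2)) * ((1 + γ ^ 2) / γ ^ 2) * (q / S) + 1 / (γ * N) + 1))
  + (1 / 2) * gaussQ ((Real.sqrt S - (1 / (4 * N)) * ((1 - γ) / γ) * (q / Real.sqrt S)) /
      Real.sqrt ((1 / (4 * N)) * ((1 + γ) / γ) * (q / S)
        + (1 / (8 * N ^ 2)) * ((1 + γ ^ 2) / γ ^ 2) * (q / S) + 1 / N + 1))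

theorem integrable_exp_neg_sq_div_two : Integrable (fun t : ℝ => Real.exp (-t ^ 2 / 2)) := by
  convert integrable_exp_neg_mul_sq (b := 1 / 2) (by norm_num) using 3
  ring

theorem hasDerivAt_gaussQ (x : ℝ) :
    HasDerivAt gaussQ (-((Real.sqrt (2 * Real.pi))⁻¹ * Real.exp (-x ^ 2 / 2))) x := by
  have hInt := integrable_exp_neg_sq_div_two
  have hcont : Continuous (fun t : ℝ => Real.exp (-t ^ 2 / 2)) := by fun_prop
  have heq : gaussQ = fun y => (Real.sqrt (2 * Real.pi))⁻¹ *
      ((∫ t in Set.Ioi 0, Real.exp (-t ^ 2 / 2)) - ∫ t in (0 : ℝ)..y, Real.exp (-t ^ 2 / 2)) := by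
    funext y
    rw [gaussQ, ← intervalIntegral.integral_Ioi_sub_Ioi' hInt.integrableOn hInt.integrableOn,
      sub_sub_cancel]
  rw [heq]
  have h := intervalIntegral.integral_hasDerivAt_right (hcont.intervalIntegrable 0 x)
    (hcont.stronglyMeasurableAtFilter _ _) hcont.continuousAt
  exact ((h.const_sub _).const_mul _).congr_deriv (by ring)

theorem hasDerivAt_gaussQ_ratio (s a b e : ℝ) :
    HasDerivAt (fun h : ℝ => gaussQ ((s + a * h) / Real.sqrt (e * h ^ 2 + b * h + 1)))
      (-((Real.sqrt (2 * Real.pi))⁻¹ * Real.exp (-s ^ 2 / 2)) * (a - s * b / 2)) 0 := by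
  have hnum : HasDerivAt (fun h : ℝ => s + a * h) a 0 := by
    simpa using ((hasDerivAt_id (0 : ℝ)).const_mul a).const_add s
  have hrad : HasDerivAt (fun h : ℝ => e * h ^ 2 + b * h + 1) b 0 := by
    simpa using ((((hasDerivAt_id (0 : ℝ)).pow 2).const_mul e).add
      ((hasDerivAt_id (0 : ℝ)).const_mul b)).add_const 1
  have harg := hnum.div (hrad.sqrt (by norm_num)) (by norm_num)
  refine ((hasDerivAt_gaussQ _).comp (0 : ℝ) harg).congr_deriv ?_
  norm_num
  left
  ring

/-- `phat` in the variable `h = N⁻¹`, in a form that is differentiable at `h = 0`. -/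
noncomputable def phatInv (S γ q h : ℝ) : ℝ :=
  (1 / 2) * gaussQ ((Real.sqrt S + (1 - γ) / (4 * γ) * (q / Real.sqrt S) * h) /
      Real.sqrt ((1 + γ ^ 2) / (8 * γ ^ 2) * (q / S) * h ^ 2
        + ((1 + γ) / (4 * γ) * (q / S) + 1 / γ) * h + 1))
  + (1 / 2) * gaussQ ((Real.sqrt S + -((1 - γ) / (4 * γ) * (q / Real.sqrt S)) * h) /
      Real.sqrt ((1 + γ ^ 2) / (8 * γ ^ 2) * (q / S) * h ^ 2
        + ((1 + γ) / (4 * γ) * (q / S) + 1) * h + 1))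

theorem phat_eq_phatInv (S N γ q : ℝ) : phat S N γ q = phatInv S γ q N⁻¹ := by
  unfold phat phatInv
  congr 4
  · ring
  · congr 1; ring
  · ring
  · congr 1; ring

theorem hasDerivAt_phatInv (S γ q : ℝ) :
    HasDerivAt (phatInv S γ q)
      ((Real.sqrt (2 * Real.pi))⁻¹ * Real.exp (-Real.sqrt S ^ 2 / 2) * Real.sqrt S / 2 *
        ((1 + γ) / (4 * γ) * (q / S) + (1 / γ + 1) / 2)) 0 := by
  unfold phatInv
  exact (((hasDerivAt_gaussQ_ratio _ _ _ _).const_mul (1 / 2)).add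
    ((hasDerivAt_gaussQ_ratio _ _ _ _).const_mul (1 / 2))).congr_deriv (by ring)

theorem phatInv_zero (S γ q : ℝ) : phatInv S γ q 0 = gaussQ (Real.sqrt S) := by
  simp only [phatInv]
  norm_num
  ring

theorem gain_for_large_N (S γ d k : ℝ) (hS : 0 < S) (hγ0 : 0 < γ) (hγ1 : γ ≤ 1)
    (hk : 1 ≤ k) (hkd : k < d) :
    ∃ N₀ : ℝ, 0 < N₀ ∧ ∀ N : ℝ, N₀ ≤ N → phat S N γ k < phat S N γ d := by
  set D : ℝ → ℝ := fun q => (Real.sqrt (2 * Real.pi))⁻¹ * Real.exp (-Real.sqrt S ^ 2 / 2) *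
    Real.sqrt S / 2 * ((1 + γ) / (4 * γ) * (q / S) + (1 / γ + 1) / 2) with hD
  have hDlt : D k < D d := by
    simp only [hD]
    gcongr
  have hderiv : HasDerivAt (fun h => phatInv S γ d h - phatInv S γ k h) (D d - D k) 0 :=
    (hasDerivAt_phatInv S γ d).sub (hasDerivAt_phatInv S γ k)
  have hpos : ∀ᶠ h in nhdsWithin (0 : ℝ) (Set.Ioi 0), phatInv S γ k h < phatInv S γ d h := by
    have hslope := (hasDerivAt_iff_tendsto_slope.mp hderiv).mono_left
      (nhdsWithin_mono 0 fun x (hx : 0 < x) => hx.ne')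
    filter_upwards [hslope.eventually_const_lt (sub_pos.mpr hDlt), self_mem_nhdsWithin]
      with h hh hh0
    have hh0' : 0 < h := hh0
    rw [slope_def_field, phatInv_zero, phatInv_zero, sub_self, sub_zero, sub_zero,
      div_pos_iff_of_pos_right hh0'] at hh
    exact sub_pos.mp hh
  obtain ⟨M, hM⟩ := Filter.eventually_atTop.mp (tendsto_inv_atTop_nhdsGT_zero.eventually hpos)
  refine ⟨max M 1, by positivity, fun N hN => ?_⟩
  rw [phat_eq_phatInv, phat_eq_phatInv]
  exact hM N ((le_max_left M 1).trans hN)
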